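/- Let f : ℝ² → ℝ be a function such that (1) there exists a set A ⊆ ℝ with μ(ℝ ∖ A) = 0 such that for every x ∈ A the vertical section y ↦ f(x,y) is quasicontinuous and upper semicontinuous, and (2) there exists a dense subset B ⊆ ℝ such that for every y ∈ B the horizontal section x ↦ f(x,y) is Lebesgue measurable. Then f is (L)-sup-measurable, i.e., for every Lebesgue measurable function φ : ℝ → ℝ the function x ↦ f(x, φ(x)) is Lebesgue measurable. -/

import Mathlib

open MeasureTheory Set Filter Topology

/-- `g : ℝ → ℝ` is quasicontinuous: for every point `y`, every `ε > 0` and every open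
neighborhood `U` of `y` there is a nonempty open `V ⊆ U` with `|g t − g y| < ε` on `V`. -/
def QuasiContinuous (g : ℝ → ℝ) : Prop :=
  ∀ y : ℝ, ∀ ε : ℝ, 0 < ε → ∀ U : Set ℝ, IsOpen U → y ∈ U →
    ∃ V : Set ℝ, V.Nonempty ∧ IsOpen V ∧ V ⊆ U ∧ ∀ t ∈ V, |g t - g y| < ε

/-- `g` is upper semicontinuous at `y₀` (ε-δ formulation). -/
def UpperSemicontinuousPt (g : ℝ → ℝ) (y₀ : ℝ) : Prop :=
  ∀ ε : ℝ, 0 < ε → ∃ δ : ℝ, 0 < δ ∧ ∀ y : ℝ, |y - y₀| < δ → g y ≤ g y₀ + ε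

/-- Lebesgue measurability: measurability with respect to the completed Lebesgue measure. -/
def LebMeasurable (g : ℝ → ℝ) : Prop :=
  MeasureTheory.NullMeasurable g (volume : Measure ℝ)

/-- Lebesgue measurability on a subset `s` of `ℝ`. -/
def LebMeasurableOn (g : ℝ → ℝ) (s : Set ℝ) : Prop :=
  MeasureTheory.NullMeasurable g ((volume : Measure ℝ).restrict s)

/-- Superlevel sets of a quasicontinuous, upper semicontinuous function are determined by its
values on a dense set. -/
theorem le_iff_forall_exists_mem_dense {g : ℝ → ℝ} {y : ℝ} (hq : QuasiContinuous g)
    (hu : UpperSemicontinuousPt g y) {C : Set ℝ} (hC : Dense C) (a : ℝ) :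
    a ≤ g y ↔ ∀ n : ℕ, ∃ c ∈ C, |c - y| < 1 / ((n : ℝ) + 1) ∧ a - 1 / ((n : ℝ) + 1) < g c := by
  constructor
  · intro ha n
    have hn : (0 : ℝ) < 1 / ((n : ℝ) + 1) := Nat.one_div_pos_of_nat
    obtain ⟨V, hVne, hVo, hVU, hV⟩ := hq y _ hn _ Metric.isOpen_ball (Metric.mem_ball_self hn)
    obtain ⟨c, hcV, hcC⟩ := hC.inter_open_nonempty V hVo hVne
    have hball := hVU hcV
    rw [Metric.mem_ball, Real.dist_eq] at hball
    have hval := (abs_lt.1 (hV c hcV)).1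
    exact ⟨c, hcC, hball, by linarith⟩
  · intro h
    refine le_of_forall_pos_le_add fun ε hε => ?_
    obtain ⟨δ, hδ, hgδ⟩ := hu (ε / 2) (half_pos hε)
    obtain ⟨n, hn⟩ := exists_nat_one_div_lt (lt_min hδ (half_pos hε))
    obtain ⟨c, -, hcy, hca⟩ := h n
    have hle := hgδ c (hcy.trans (hn.trans_le (min_le_left _ _)))
    have hnε := hn.trans_le (min_le_right _ _)
    linarith

theorem sup_measurable_ae_sections (f : ℝ → ℝ → ℝ)
    (A : Set ℝ) (hA : volume Aᶜ = 0)
    (h1 : ∀ x ∈ A, QuasiContinuous (f x) ∧ ∀ y₀ : ℝ, UpperSemicontinuousPt (f x) y₀)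
    (B : Set ℝ) (hBd : Dense B)
    (h2 : ∀ y ∈ B, LebMeasurable (fun x => f x y)) :
    ∀ φ : ℝ → ℝ, LebMeasurable φ → LebMeasurable (fun x => f x (φ x)) := by
  intro φ hφ
  obtain ⟨C, hCB, hCc, hCd⟩ := hBd.exists_countable_dense_subset
  refine measurable_of_Ici (δ := NullMeasurableSpace ℝ volume) fun a => ?_
  have hmeas : NullMeasurableSet (⋂ n : ℕ, ⋃ c ∈ C,
      φ ⁻¹' {t | |c - t| < 1 / ((n : ℝ) + 1)} ∩
        (fun x => f x c) ⁻¹' Ioi (a - 1 / ((n : ℝ) + 1))) volume := by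
    refine NullMeasurableSet.iInter fun n => NullMeasurableSet.biUnion hCc fun c hc => ?_
    refine NullMeasurableSet.inter (hφ ?_) (h2 c (hCB hc) measurableSet_Ioi)
    exact measurableSet_lt (by fun_prop) measurable_const
  refine hmeas.congr ?_
  have hAae : ∀ᵐ x, x ∈ A := hA
  refine eventuallyEq_set.2 ?_
  filter_upwards [hAae] with x hx
  have key := le_iff_forall_exists_mem_dense (h1 x hx).1 ((h1 x hx).2 (φ x)) hCd a
  simp only [mem_iInter, mem_iUnion, exists_prop]
  exact key.symm
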